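/- Let b be a rational, non-inner function in the closed unit ball of H^∞ with ‖b‖_∞ = 1, Pythagorean mate a with zeros ζ₁,…,ζ_l on 𝕋 of multiplicities m₁,…,m_l. Suppose Λ = (λ_n) is a sequence in 𝔻 satisfying the Carleson condition and Σ_{n∈ℕ} (1−|λ_n|²)/|ζ_j−λ_n|^{2m_j} < ∞ for every 1 ≤ j ≤ l. Then for every bounded sequence (v_n) ∈ ℓ^∞ there exist F ∈ H^∞ and g ∈ H² with F(z) = ∏_{j=1}^l (z−ζ_j)^{m_j} g(z) on 𝔻 (i.e. F ∈ aH² ∩ H^∞) and F(λ_n) = v_n for all n; in particular Λ is multiplier interpolating for H(b). -/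

import Mathlib

open Complex MeasureTheory Metric Set Finset Filter ProbabilityTheory Polynomial
open scoped ENNReal NNReal Topology

noncomputable section

/-- Membership in the Hardy space `H²` of the unit disk: `f` is holomorphic on `𝔻` and the
mean-square integrals over circles of radius `r < 1` are uniformly bounded. -/
def MemHardy2 (f : ℂ → ℂ) : Prop :=
  DifferentiableOn ℂ f (ball (0 : ℂ) 1) ∧
  ∃ C : ℝ, ∀ r : ℝ, 0 < r → r < 1 →
    (1 / (2 * Real.pi)) * ∫ t in (0 : ℝ)..(2 * Real.pi),
      ‖f ((r : ℂ) * Complex.exp ((t : ℂ) * Complex.I))‖ ^ 2 ≤ C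

/-- The squared `H²` norm of `f`, as the supremum of the circle means. -/
def h2NormSq (f : ℂ → ℂ) : ℝ :=
  sSup {y : ℝ | ∃ r : ℝ, 0 < r ∧ r < 1 ∧
    y = (1 / (2 * Real.pi)) * ∫ t in (0 : ℝ)..(2 * Real.pi),
      ‖f ((r : ℂ) * Complex.exp ((t : ℂ) * Complex.I))‖ ^ 2}

/-- Membership in the de Branges-Rovnyak space `H(b)`, where `b` is rational and non-extreme
with Pythagorean mate `a` whose zeros on the circle are `ζ j` with multiplicities `m j`:
`f = ∏ (z - ζ j)^(m j) · g + p` on `𝔻` with `g ∈ H²` and `p` a polynomial of degree `< ∑ m j`. -/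
def MemHb {l : ℕ} (ζ : Fin l → ℂ) (m : Fin l → ℕ) (f : ℂ → ℂ) : Prop :=
  ∃ (g : ℂ → ℂ) (p : Polynomial ℂ), MemHardy2 g ∧ p.degree < ((∑ j, m j : ℕ) : ℕ) ∧
    ∀ z ∈ ball (0 : ℂ) 1, f z = (∏ j, (z - ζ j) ^ m j) * g z + p.eval z

/-- The Carleson condition: the pseudohyperbolic products `∏_{k ≠ n} ρ(Λ n, Λ k)` are
uniformly bounded below (formulated over all finite subsets not containing `n`). -/
def CarlesonCond (Λ : ℕ → ℂ) : Prop :=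
  ∃ δ : ℝ, 0 < δ ∧ ∀ n : ℕ, ∀ F : Finset ℕ, n ∉ F →
    δ ≤ ∏ k ∈ F, ‖(Λ n - Λ k) / (1 - (starRingEnd ℂ) (Λ k) * Λ n)‖

/-- `Λ` is universal interpolating for `H(b)`: the restriction map
`f ↦ (f(Λ n)/‖k^b_{Λ n}‖)` is bounded from `H(b)` into `ℓ²` and onto `ℓ²`.  Here
`‖k^b_λ‖² = (1-|b(λ)|²)/(1-|λ|²)`, and the `H(b)` norm of `f = ∏(z-ζ_j)^{m_j} g + p` is
`(‖g‖² + ‖p‖²)^{1/2}`. -/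
def UnivInterp {l : ℕ} (ζ : Fin l → ℂ) (m : Fin l → ℕ) (b : ℂ → ℂ) (Λ : ℕ → ℂ) : Prop :=
  (∃ C : ℝ, ∀ (g : ℂ → ℂ) (p : Polynomial ℂ), MemHardy2 g → p.degree < ((∑ j, m j : ℕ) : ℕ) →
    ∀ F : Finset ℕ,
      ∑ n ∈ F, ‖(∏ j, (Λ n - ζ j) ^ m j) * g (Λ n) + p.eval (Λ n)‖ ^ 2 *
          ((1 - ‖Λ n‖ ^ 2) / (1 - ‖b (Λ n)‖ ^ 2)) ≤
        C * (h2NormSq g + h2NormSq fun z => p.eval z)) ∧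
  ∀ w : ℕ → ℂ, Summable (fun n => ‖w n‖ ^ 2) →
    ∃ f : ℂ → ℂ, MemHb ζ m f ∧
      ∀ n, f (Λ n) * (Real.sqrt ((1 - ‖Λ n‖ ^ 2) / (1 - ‖b (Λ n)‖ ^ 2)) : ℂ) = w n

/-- `Λ` is multiplier interpolating for `H(b)`: every bounded sequence can be interpolated
by a multiplier of `H(b)`. -/
def MultInterp {l : ℕ} (ζ : Fin l → ℂ) (m : Fin l → ℕ) (Λ : ℕ → ℂ) : Prop :=
  ∀ v : ℕ → ℂ, (∃ C : ℝ, ∀ n, ‖v n‖ ≤ C) →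
    ∃ φ : ℂ → ℂ, (∀ f : ℂ → ℂ, MemHb ζ m f → MemHb ζ m fun z => φ z * f z) ∧
      ∀ n, φ (Λ n) = v n

local notation "conj" => starRingEnd ℂ

lemma norm_one_sub_conj_mul_sq_sub (w z : ℂ) :
    ‖1 - conj w * z‖ ^ 2 - ‖z - w‖ ^ 2 = (1 - ‖w‖ ^ 2) * (1 - ‖z‖ ^ 2) := by
  simp only [← Complex.normSq_eq_norm_sq, Complex.normSq_apply]
  simp
  ring

lemma one_sub_mul_le_norm_one_sub_conj_mul (w z : ℂ) :
    1 - ‖w‖ * ‖z‖ ≤ ‖1 - conj w * z‖ := by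
  have := norm_sub_norm_le (1 : ℂ) (conj w * z)
  simpa using this

lemma one_sub_norm_sq_pos {w : ℂ} (hw : ‖w‖ < 1) : 0 < 1 - ‖w‖ ^ 2 := by
  nlinarith [norm_nonneg w]

lemma one_sub_norm_sq_le_one (w : ℂ) : 1 - ‖w‖ ^ 2 ≤ 1 := by
  nlinarith [norm_nonneg w]

lemma norm_one_sub_conj_mul_pos {w z : ℂ} (hw : ‖w‖ < 1) (hz : ‖z‖ < 1) :
    0 < ‖1 - conj w * z‖ := by
  have := one_sub_mul_le_norm_one_sub_conj_mul w z
  nlinarith [norm_nonneg w, norm_nonneg z]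

lemma one_sub_conj_mul_ne_zero {w z : ℂ} (hw : ‖w‖ < 1) (hz : ‖z‖ < 1) :
    1 - conj w * z ≠ 0 :=
  norm_pos_iff.1 (norm_one_sub_conj_mul_pos hw hz)

lemma one_sub_norm_le_norm_one_sub_conj_mul {w : ℂ} (hw : ‖w‖ < 1) (z : ℂ) :
    1 - ‖z‖ ≤ ‖1 - conj w * z‖ := by
  have := one_sub_mul_le_norm_one_sub_conj_mul w z
  nlinarith [norm_nonneg w, norm_nonneg z]

/-- The Cayley transform `(1 + w̄z)/(1 - w̄z)`, whose real part is the Poisson-type kernel. -/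
def cayleyKernel (w z : ℂ) : ℂ := (1 + conj w * z) / (1 - conj w * z)

lemma cayleyKernel_re (w z : ℂ) :
    (cayleyKernel w z).re = (1 - ‖w‖ ^ 2 * ‖z‖ ^ 2) / ‖1 - conj w * z‖ ^ 2 := by
  have h : ‖w‖ ^ 2 * ‖z‖ ^ 2 = ‖conj w * z‖ ^ 2 := by simp [mul_pow]
  rw [cayleyKernel, h]
  simp only [← Complex.normSq_eq_norm_sq, Complex.div_re, ← add_div]
  congr 1
  generalize conj w * z = u
  simp [Complex.normSq_apply]
  ring

lemma cayleyKernel_re_nonneg {w z : ℂ} (hw : ‖w‖ < 1) (hz : ‖z‖ < 1) :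
    0 ≤ (cayleyKernel w z).re := by
  rw [cayleyKernel_re]
  have : ‖w‖ * ‖z‖ ≤ 1 := by nlinarith [norm_nonneg w, norm_nonneg z]
  have : 0 ≤ 1 - ‖w‖ ^ 2 * ‖z‖ ^ 2 := by
    nlinarith [mul_nonneg (norm_nonneg w) (norm_nonneg z)]
  positivity

lemma norm_cayleyKernel_le {w z : ℂ} (hw : ‖w‖ < 1) {r : ℝ} (hr : r < 1) (hz : ‖z‖ ≤ r) :
    ‖cayleyKernel w z‖ ≤ 2 / (1 - r) := by
  have h1 := one_sub_norm_le_norm_one_sub_conj_mul hw z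
  rw [cayleyKernel, norm_div]
  have h2 : ‖1 + conj w * z‖ ≤ 2 := by
    refine (norm_add_le _ _).trans ?_
    simp only [norm_one, norm_mul, RCLike.norm_conj]
    nlinarith [norm_nonneg w, norm_nonneg z]
  have : 0 < 1 - r := by linarith
  gcongr
  linarith

lemma differentiableOn_cayleyKernel {w : ℂ} (hw : ‖w‖ < 1) :
    DifferentiableOn ℂ (cayleyKernel w) (ball 0 1) := by
  unfold cayleyKernel
  refine DifferentiableOn.div (by fun_prop) (by fun_prop) fun z hz => ?_
  exact one_sub_conj_mul_ne_zero hw (by simpa using hz)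

/-- A function differentiable on every smaller disk is differentiable on the unit disk. -/
lemma differentiableOn_ball_of_forall_lt {f : ℂ → ℂ}
    (h : ∀ r : ℝ, 0 < r → r < 1 → DifferentiableOn ℂ f (ball 0 r)) :
    DifferentiableOn ℂ f (ball 0 1) := by
  intro z hz
  rw [mem_ball_zero_iff] at hz
  obtain ⟨r, hr, hr1⟩ := exists_between hz
  exact ((h r ((norm_nonneg z).trans_lt hr) hr1).differentiableAt
    (isOpen_ball.mem_nhds (by simpa using hr))).differentiableWithinAt

section Carleson

variable {Λ : ℕ → ℂ}

lemma CarlesonCond.exists_sum_le (hΛ : ∀ n, ‖Λ n‖ < 1) (hC : CarlesonCond Λ) :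
    ∃ L : ℝ, 0 ≤ L ∧ ∀ n, ∀ F : Finset ℕ,
      ∑ k ∈ F, (1 - ‖Λ k‖ ^ 2) * (1 - ‖Λ n‖ ^ 2) / ‖1 - conj (Λ k) * Λ n‖ ^ 2 ≤ L := by
  obtain ⟨δ, hδ, H⟩ := hC
  have hδ1 : δ ≤ 1 := by simpa using H 0 ∅ (by simp)
  have key : ∀ n, ∀ F : Finset ℕ, n ∉ F →
      ∑ k ∈ F, (1 - ‖Λ k‖ ^ 2) * (1 - ‖Λ n‖ ^ 2) / ‖1 - conj (Λ k) * Λ n‖ ^ 2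
        ≤ - Real.log (δ ^ 2) := by
    intro n F hn
    set t : ℕ → ℝ := fun k =>
      (1 - ‖Λ k‖ ^ 2) * (1 - ‖Λ n‖ ^ 2) / ‖1 - conj (Λ k) * Λ n‖ ^ 2 with ht
    have h1 : ∀ k, ‖(Λ n - Λ k) / (1 - conj (Λ k) * Λ n)‖ ^ 2 = 1 - t k := by
      intro k
      have hp := norm_one_sub_conj_mul_pos (hΛ k) (hΛ n)
      simp only [ht]
      rw [← norm_one_sub_conj_mul_sq_sub, norm_div, div_pow, sub_div, div_self (by positivity)]
      ring
    have h2 : δ ^ 2 ≤ Real.exp (- ∑ k ∈ F, t k) := by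
      calc δ ^ 2 ≤ (∏ k ∈ F, ‖(Λ n - Λ k) / (1 - conj (Λ k) * Λ n)‖) ^ 2 := by
            gcongr
            exact H n F hn
        _ = ∏ k ∈ F, (1 - t k) := by
            rw [← Finset.prod_pow]
            exact Finset.prod_congr rfl fun k _ => h1 k
        _ ≤ ∏ k ∈ F, Real.exp (- t k) := by
            refine Finset.prod_le_prod (fun k _ => h1 k ▸ sq_nonneg _) fun k _ => ?_
            linarith [Real.add_one_le_exp (- t k)]
        _ = Real.exp (- ∑ k ∈ F, t k) := by
            rw [← Real.exp_sum, Finset.sum_neg_distrib]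
    have h3 := Real.log_le_log (by positivity) h2
    rw [Real.log_exp] at h3
    linarith
  have hlog : Real.log (δ ^ 2) ≤ 0 := Real.log_nonpos (by positivity) (by nlinarith)
  refine ⟨1 - Real.log (δ ^ 2), by linarith, fun n F => ?_⟩
  have hpos : ∀ k, 0 ≤ (1 - ‖Λ k‖ ^ 2) * (1 - ‖Λ n‖ ^ 2) / ‖1 - conj (Λ k) * Λ n‖ ^ 2 := by
    intro k
    have := one_sub_norm_sq_pos (hΛ k)
    have := one_sub_norm_sq_pos (hΛ n)
    positivity
  have hself : (1 - ‖Λ n‖ ^ 2) * (1 - ‖Λ n‖ ^ 2) / ‖1 - conj (Λ n) * Λ n‖ ^ 2 = 1 := by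
    have hp := norm_one_sub_conj_mul_pos (hΛ n) (hΛ n)
    have := norm_one_sub_conj_mul_sq_sub (Λ n) (Λ n)
    rw [← this]
    simp only [sub_self, norm_zero]
    field_simp
    ring
  calc _ ≤ ∑ k ∈ insert n (F.erase n),
        (1 - ‖Λ k‖ ^ 2) * (1 - ‖Λ n‖ ^ 2) / ‖1 - conj (Λ k) * Λ n‖ ^ 2 := by
        refine Finset.sum_le_sum_of_subset_of_nonneg ?_ fun k _ _ => hpos k
        intro k hk
        by_cases h : k = n <;> simp [h, hk]
    _ ≤ _ := by
        rw [Finset.sum_insert (by simp), hself]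
        linarith [key n (F.erase n) (by simp)]

lemma CarlesonCond.summable (hΛ : ∀ n, ‖Λ n‖ < 1) (hC : CarlesonCond Λ) :
    Summable fun n => 1 - ‖Λ n‖ ^ 2 := by
  obtain ⟨L, hL0, hL⟩ := hC.exists_sum_le hΛ
  have h0 := one_sub_norm_sq_pos (hΛ 0)
  refine summable_of_sum_le (c := 4 * L / (1 - ‖Λ 0‖ ^ 2))
    (fun n => (one_sub_norm_sq_pos (hΛ n)).le) fun F => ?_
  rw [le_div_iff₀ h0, Finset.sum_mul]
  refine le_trans ?_ (mul_le_mul_of_nonneg_left (hL 0 F) (by norm_num : (0:ℝ) ≤ 4))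
  rw [Finset.mul_sum]
  refine Finset.sum_le_sum fun k _ => ?_
  have hp := norm_one_sub_conj_mul_pos (hΛ k) (hΛ 0)
  have hk := one_sub_norm_sq_pos (hΛ k)
  have h2 : ‖1 - conj (Λ k) * Λ 0‖ ≤ 2 := by
    refine (norm_sub_le _ _).trans ?_
    simp only [norm_one, norm_mul, RCLike.norm_conj]
    nlinarith [norm_nonneg (Λ k), norm_nonneg (Λ 0), hΛ k, hΛ 0]
  rw [← mul_div_assoc, le_div_iff₀ (by positivity)]
  have : ‖1 - conj (Λ k) * Λ 0‖ ^ 2 ≤ 4 := by nlinarith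
  nlinarith [mul_pos hk h0]

end Carleson

/-- The Blaschke factor with zero `w`, normalised to be positive at the origin if `w ≠ 0`. -/
def blaschkeFactor (w z : ℂ) : ℂ :=
  (if w = 0 then 1 else -(conj w / ‖w‖)) * ((z - w) / (1 - conj w * z))

lemma norm_blaschkeFactor (w z : ℂ) :
    ‖blaschkeFactor w z‖ = ‖(z - w) / (1 - conj w * z)‖ := by
  rw [blaschkeFactor, norm_mul]
  split_ifs with h
  · simp
  · have : ‖w‖ ≠ 0 := norm_ne_zero_iff.2 h
    simp [this]

lemma blaschkeFactor_self (w : ℂ) : blaschkeFactor w w = 0 := by simp [blaschkeFactor]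

lemma norm_blaschkeFactor_le_one {w z : ℂ} (hw : ‖w‖ < 1) (hz : ‖z‖ < 1) :
    ‖blaschkeFactor w z‖ ≤ 1 := by
  rw [norm_blaschkeFactor, norm_div]
  refine div_le_one_of_le₀ ?_ (norm_nonneg _)
  have h := norm_one_sub_conj_mul_sq_sub w z
  have := mul_pos (one_sub_norm_sq_pos hw) (one_sub_norm_sq_pos hz)
  exact le_of_sq_le_sq (by linarith) (norm_nonneg _)

lemma differentiableOn_blaschkeFactor {w : ℂ} (hw : ‖w‖ < 1) :
    DifferentiableOn ℂ (blaschkeFactor w) (ball 0 1) := by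
  unfold blaschkeFactor
  refine DifferentiableOn.const_mul (DifferentiableOn.div (by fun_prop) (by fun_prop) ?_) _
  exact fun z hz => one_sub_conj_mul_ne_zero hw (by simpa using hz)

lemma norm_blaschkeFactor_sub_one_le {w z : ℂ} {r : ℝ} (hw : ‖w‖ < 1) (hr : r < 1)
    (hz : ‖z‖ ≤ r) : ‖blaschkeFactor w z - 1‖ ≤ 2 / (1 - r) * (1 - ‖w‖ ^ 2) := by
  have hden := one_sub_conj_mul_ne_zero hw (hz.trans_lt hr)
  have hge := one_sub_norm_le_norm_one_sub_conj_mul hw z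
  have hr' : 0 < 1 - r := by linarith
  have hnum : ∃ u : ℂ, blaschkeFactor w z - 1 = u / (1 - conj w * z) ∧
      ‖u‖ ≤ 2 * (1 - ‖w‖ ^ 2) := by
    by_cases h : w = 0
    · refine ⟨z - 1, by simp [h, blaschkeFactor], ?_⟩
      refine (norm_sub_le _ _).trans ?_
      simp only [norm_one, h, norm_zero]
      linarith
    · have hw0 : (‖w‖ : ℂ) ≠ 0 := by simpa using h
      have hww : conj w * w = (‖w‖ : ℂ) ^ 2 := by
        rw [← Complex.normSq_eq_conj_mul_self, Complex.normSq_eq_norm_sq]; simp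
      refine ⟨-((1 - (‖w‖ : ℂ)) * (1 + conj w / ‖w‖ * z)), ?_, ?_⟩
      · rw [blaschkeFactor, if_neg h, eq_div_iff hden, sub_mul, mul_assoc, div_mul_cancel₀ _ hden]
        field_simp
        linear_combination hww
      · have h1 : ‖(1 : ℂ) - (‖w‖ : ℂ)‖ = 1 - ‖w‖ := by
          rw [← Complex.ofReal_one, ← Complex.ofReal_sub, Complex.norm_real, Real.norm_of_nonneg]
          linarith
        have h2 : ‖1 + conj w / ‖w‖ * z‖ ≤ 2 := by
          refine (norm_add_le _ _).trans ?_
          have : ‖w‖ ≠ 0 := norm_ne_zero_iff.2 h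
          simp only [norm_one, norm_mul, norm_div, RCLike.norm_conj, Complex.norm_real, norm_norm,
            div_self this]
          linarith
        rw [norm_neg, norm_mul, h1]
        nlinarith [norm_nonneg w]
  obtain ⟨u, hu, hu'⟩ := hnum
  rw [hu, norm_div, div_mul_eq_mul_div]
  have := one_sub_norm_sq_pos hw
  gcongr
  linarith

/-- The Blaschke product over all points of `Λ` but the `n`-th one. -/
lemma exists_blaschkeProduct {Λ : ℕ → ℂ} (hΛ : ∀ n, ‖Λ n‖ < 1)
    (hs : Summable fun n => 1 - ‖Λ n‖ ^ 2) (n : ℕ) :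
    ∃ B : ℂ → ℂ, DifferentiableOn ℂ B (ball 0 1) ∧ (∀ z ∈ ball (0 : ℂ) 1, ‖B z‖ ≤ 1) ∧
      (∀ k, k ≠ n → B (Λ k) = 0) ∧
      ∀ δ : ℝ, (∀ F : Finset ℕ, n ∉ F →
        δ ≤ ∏ k ∈ F, ‖(Λ n - Λ k) / (1 - conj (Λ k) * Λ n)‖) → δ ≤ ‖B (Λ n)‖ := by
  set f : ℕ → ℂ → ℂ := fun k z => if k = n then 1 else blaschkeFactor (Λ k) z with hf
  have hfd : ∀ k, DifferentiableOn ℂ (f k) (ball 0 1) := by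
    intro k
    by_cases h : k = n
    · simp only [hf, h, if_true]; fun_prop
    · simpa only [hf, h, if_false] using differentiableOn_blaschkeFactor (hΛ k)
  have hprod : ∀ r : ℝ, 0 < r → r < 1 →
      HasProdLocallyUniformlyOn f (fun z => ∏' k, f k z) (ball 0 r) := by
    intro r hr hr1
    have h := Summable.hasProdLocallyUniformlyOn_one_add (f := fun k z => f k z - 1)
      (u := fun k => 2 / (1 - r) * (1 - ‖Λ k‖ ^ 2)) (K := ball (0 : ℂ) r) isOpen_ball
      (hs.mul_left _) ?_ ?_
    · simpa using h
    · refine Eventually.of_forall fun k z hz => ?_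
      rw [mem_ball_zero_iff] at hz
      by_cases h : k = n
      · simp only [hf, h, if_true, sub_self, norm_zero]
        have := one_sub_norm_sq_pos (hΛ n)
        have : 0 < 1 - r := by linarith
        positivity
      · simp only [hf, h, if_false]
        exact norm_blaschkeFactor_sub_one_le (hΛ k) hr1 hz.le
    · intro k
      exact (((hfd k).mono (ball_subset_ball hr1.le)).continuousOn).sub continuousOn_const
  have hasprod : ∀ z ∈ ball (0 : ℂ) 1, HasProd (fun k => f k z) (∏' k, f k z) := by
    intro z hz
    rw [mem_ball_zero_iff] at hz
    obtain ⟨r, hr, hr1⟩ := exists_between hz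
    exact (hprod r ((norm_nonneg z).trans_lt hr) hr1).hasProd (by simpa using hr)
  refine ⟨fun z => ∏' k, f k z, ?_, ?_, ?_, ?_⟩
  · refine differentiableOn_ball_of_forall_lt fun r hr hr1 => ?_
    refine (hasProdLocallyUniformlyOn_iff_tendstoLocallyUniformlyOn.1
      (hprod r hr hr1)).differentiableOn
      (Eventually.of_forall fun F => ?_) isOpen_ball
    have : DifferentiableOn ℂ (fun z => ∏ k ∈ F, f k z) (ball 0 1) :=
      DifferentiableOn.fun_finsetProd fun k _ => hfd k
    exact this.mono (ball_subset_ball hr1.le)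
  · intro z hz
    refine le_of_tendsto ((hasprod z hz).norm) (Eventually.of_forall fun F => ?_)
    refine Finset.prod_le_one (fun _ _ => norm_nonneg _) fun k _ => ?_
    by_cases h : k = n
    · simp [hf, h]
    · simpa [hf, h] using norm_blaschkeFactor_le_one (hΛ k) (by simpa using hz)
  · intro k hk
    exact tprod_of_exists_eq_zero ⟨k, by simp [hf, hk, blaschkeFactor_self]⟩
  · intro δ hδ
    refine ge_of_tendsto ((hasprod (Λ n) (by simpa using hΛ n)).norm)
      (Eventually.of_forall fun F => ?_)
    refine (hδ (F.erase n) (by simp)).trans_eq ?_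
    have h1 : ∏ k ∈ F, ‖f k (Λ n)‖ = ∏ k ∈ F.erase n, ‖f k (Λ n)‖ := by
      refine (Finset.prod_subset (Finset.erase_subset _ _) fun k _ hk' => ?_).symm
      have : k = n := by
        by_contra h
        exact hk' (Finset.mem_erase.2 ⟨h, ‹_›⟩)
      simp [hf, this]
    refine Eq.trans ?_ h1.symm
    refine Finset.prod_congr rfl fun k hk => ?_
    simp [hf, Finset.ne_of_mem_erase hk, norm_blaschkeFactor]

lemma sum_mul_exp_neg_sum_le (r a : ℕ → ℝ) (ha : ∀ k, 0 ≤ a k) (J : Finset ℕ) :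
    ∑ n ∈ J, a n * Real.exp (-∑ k ∈ J with r n ≤ r k, a k) ≤ 1 - Real.exp (-∑ k ∈ J, a k) := by
  induction J using Finset.induction_on_min_value r with
  | empty => simp
  | insert i J hi hmin ih =>
    have hfilter : {k ∈ insert i J | r i ≤ r k} = insert i J := by
      refine Finset.filter_true_of_mem fun k hk => ?_
      rcases Finset.mem_insert.1 hk with rfl | hk
      · exact le_rfl
      · exact hmin k hk
    rw [Finset.sum_insert hi, hfilter, Finset.sum_insert hi]
    have h1 : ∑ n ∈ J, a n * Real.exp (-∑ k ∈ insert i J with r n ≤ r k, a k)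
        ≤ ∑ n ∈ J, a n * Real.exp (-∑ k ∈ J with r n ≤ r k, a k) := by
      refine Finset.sum_le_sum fun n _ => mul_le_mul_of_nonneg_left ?_ (ha n)
      refine Real.exp_le_exp.2 (neg_le_neg ?_)
      exact Finset.sum_le_sum_of_subset_of_nonneg
        (Finset.filter_subset_filter _ (Finset.subset_insert _ _)) fun k _ _ => ha k
    set T := ∑ k ∈ J, a k
    have h2 : (a i + 1) * Real.exp (-(a i + T)) ≤ Real.exp (-T) := by
      calc _ ≤ Real.exp (a i) * Real.exp (-(a i + T)) := by
            gcongr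
            exact Real.add_one_le_exp _
        _ = _ := by rw [← Real.exp_add]; congr 1; ring
    linarith

/-- The exponent in Jones' interpolation formula. -/
lemma exists_jonesExponent {Λ : ℕ → ℂ} (hΛ : ∀ n, ‖Λ n‖ < 1)
    (hs : Summable fun n => 1 - ‖Λ n‖ ^ 2) (n : ℕ) :
    ∃ G : ℂ → ℂ, DifferentiableOn ℂ G (ball 0 1) ∧ ∀ z ∈ ball (0 : ℂ) 1,
      HasSum (fun k => if ‖Λ n‖ ≤ ‖Λ k‖ then
        (1 - ‖Λ k‖ ^ 2) * (cayleyKernel (Λ k) z).re else 0) (G z).re := by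
  set f : ℕ → ℂ → ℂ := fun k z =>
    if ‖Λ n‖ ≤ ‖Λ k‖ then ((1 - ‖Λ k‖ ^ 2 : ℝ) : ℂ) * cayleyKernel (Λ k) z else 0 with hf
  have hbound : ∀ r : ℝ, r < 1 → ∀ k, ∀ z : ℂ, ‖z‖ ≤ r →
      ‖f k z‖ ≤ (1 - ‖Λ k‖ ^ 2) * (2 / (1 - r)) := by
    intro r hr k z hz
    have h1 := one_sub_norm_sq_pos (hΛ k)
    have h2 : 0 < 1 - r := by linarith
    simp only [hf]
    split_ifs
    · rw [norm_mul, Complex.norm_real, Real.norm_of_nonneg h1.le]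
      gcongr
      exact norm_cayleyKernel_le (hΛ k) hr hz
    · rw [norm_zero]; positivity
  have hfd : ∀ k, DifferentiableOn ℂ (f k) (ball 0 1) := by
    intro k
    simp only [hf]
    split_ifs
    · exact (differentiableOn_cayleyKernel (hΛ k)).const_mul _
    · fun_prop
  refine ⟨fun z => ∑' k, f k z, ?_, fun z hz => ?_⟩
  · refine differentiableOn_ball_of_forall_lt fun r hr hr1 => ?_
    refine Complex.differentiableOn_tsum_of_summable_norm (hs.mul_right (2 / (1 - r)))
      (fun k => (hfd k).mono (ball_subset_ball hr1.le)) isOpen_ball fun k z hz => ?_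
    exact hbound r hr1 k z (by simpa using (mem_ball_zero_iff.1 hz).le)
  · have hsum : Summable fun k => f k z :=
      (hs.mul_right (2 / (1 - ‖z‖))).of_norm_bounded fun k =>
        hbound ‖z‖ (by simpa using hz) k z le_rfl
    convert Complex.hasSum_re hsum.hasSum using 2 with k
    simp only [hf]
    split_ifs
    · rw [Complex.re_ofReal_mul]
    · simp

/-- Jones' kernels: bounded analytic functions `K n` with `K n (Λ k) = δ_{nk}` whose absolute
values have a bounded sum on the disk. -/
lemma CarlesonCond.exists_interpolating_kernels {Λ : ℕ → ℂ} (hΛ : ∀ n, ‖Λ n‖ < 1)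
    (hC : CarlesonCond Λ) :
    ∃ C : ℝ, 0 < C ∧ ∃ K : ℕ → ℂ → ℂ, (∀ n, DifferentiableOn ℂ (K n) (ball 0 1)) ∧
      (∀ n, K n (Λ n) = 1) ∧ (∀ n k, k ≠ n → K n (Λ k) = 0) ∧
      (∀ n, ∀ z ∈ ball (0 : ℂ) 1,
        ‖K n z‖ ≤ C * ((1 - ‖Λ n‖ ^ 2) ^ 2 / ‖1 - conj (Λ n) * z‖ ^ 2)) ∧
      ∀ z ∈ ball (0 : ℂ) 1, ∀ J : Finset ℕ, ∑ n ∈ J, ‖K n z‖ ≤ C := by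
  have hs := hC.summable hΛ
  obtain ⟨L, hL0, hL⟩ := hC.exists_sum_le hΛ
  obtain ⟨δ, hδ, hδF⟩ := hC
  choose B hBd hB1 hB0 hBδ using exists_blaschkeProduct hΛ hs
  choose G hGd hG using exists_jonesExponent hΛ hs
  have hBn : ∀ n, δ ≤ ‖B n (Λ n)‖ := fun n => hBδ n δ (hδF n)
  have hBne : ∀ n, B n (Λ n) ≠ 0 := fun n => norm_pos_iff.1 (hδ.trans_le (hBn n))
  have hmem : ∀ n, Λ n ∈ ball (0 : ℂ) 1 := fun n => by simpa using hΛ n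
  have hterm : ∀ z ∈ ball (0 : ℂ) 1, ∀ k, 0 ≤ (1 - ‖Λ k‖ ^ 2) * (cayleyKernel (Λ k) z).re :=
    fun z hz k => mul_nonneg (one_sub_norm_sq_pos (hΛ k)).le
      (cayleyKernel_re_nonneg (hΛ k) (by simpa using hz))
  have hGsum : ∀ n, ∀ z ∈ ball (0 : ℂ) 1, ∀ J : Finset ℕ,
      ∑ k ∈ J with ‖Λ n‖ ≤ ‖Λ k‖, (1 - ‖Λ k‖ ^ 2) * (cayleyKernel (Λ k) z).re ≤ (G n z).re := by
    intro n z hz J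
    rw [Finset.sum_filter]
    refine sum_le_hasSum J (fun k _ => ?_) (hG n z hz)
    split_ifs
    · exact hterm z hz k
    · exact le_rfl
  have hGself : ∀ n, (G n (Λ n)).re ≤ 2 * L := by
    intro n
    refine hasSum_le_of_sum_le (hG n (Λ n) (hmem n)) fun J => ?_
    refine le_trans ?_ (mul_le_mul_of_nonneg_left (hL n J) (by norm_num : (0 : ℝ) ≤ 2))
    rw [Finset.mul_sum]
    refine Finset.sum_le_sum fun k _ => ?_
    have hp := norm_one_sub_conj_mul_pos (hΛ k) (hΛ n)
    have hk := one_sub_norm_sq_pos (hΛ k)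
    have hn := one_sub_norm_sq_pos (hΛ n)
    split_ifs with h
    · rw [cayleyKernel_re, ← mul_div_assoc, ← mul_div_assoc]
      gcongr ?_ / _
      have h1 : ‖Λ n‖ ^ 2 ≤ ‖Λ k‖ ^ 2 := by gcongr
      have h2 : ‖Λ n‖ ^ 2 * ‖Λ n‖ ^ 2 ≤ ‖Λ k‖ ^ 2 * ‖Λ n‖ ^ 2 := by gcongr
      have h3 : 1 - ‖Λ k‖ ^ 2 * ‖Λ n‖ ^ 2 ≤ 2 * (1 - ‖Λ n‖ ^ 2) := by
        nlinarith [sq_nonneg (‖Λ n‖ ^ 2 - 1)]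
      nlinarith
    · positivity
  set K : ℕ → ℂ → ℂ := fun n z =>
    B n z / B n (Λ n) * ((1 - ‖Λ n‖ ^ 2 : ℝ) / (1 - conj (Λ n) * z)) ^ 2 *
      Complex.exp (G n (Λ n) - G n z) with hK
  set C : ℝ := δ⁻¹ * Real.exp (2 * L) with hCdef
  have hCpos : 0 < C := by positivity
  have hKle : ∀ n, ∀ z ∈ ball (0 : ℂ) 1, ‖K n z‖ ≤
      C * ((1 - ‖Λ n‖ ^ 2) ^ 2 / ‖1 - conj (Λ n) * z‖ ^ 2 * Real.exp (-(G n z).re)) := by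
    intro n z hz
    have hn := one_sub_norm_sq_pos (hΛ n)
    have hp := norm_one_sub_conj_mul_pos (hΛ n) (by simpa using hz : ‖z‖ < 1)
    have h1 : ‖B n z / B n (Λ n)‖ ≤ δ⁻¹ := by
      rw [norm_div, div_eq_mul_inv, ← one_mul δ⁻¹]
      have := hB1 n z hz
      have := hBn n
      gcongr
    have h2 : ‖Complex.exp (G n (Λ n) - G n z)‖ ≤
        Real.exp (2 * L) * Real.exp (-(G n z).re) := by
      rw [Complex.norm_exp, ← Real.exp_add, Complex.sub_re]
      have := hGself n
      gcongr
      linarith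
    have h3 : ‖(((1 - ‖Λ n‖ ^ 2 : ℝ) : ℂ) / (1 - conj (Λ n) * z)) ^ 2‖ =
        (1 - ‖Λ n‖ ^ 2) ^ 2 / ‖1 - conj (Λ n) * z‖ ^ 2 := by
      rw [norm_pow, norm_div, Complex.norm_real, Real.norm_of_nonneg hn.le, div_pow]
    rw [hK]
    simp only [norm_mul]
    rw [h3]
    calc _ ≤ δ⁻¹ * ((1 - ‖Λ n‖ ^ 2) ^ 2 / ‖1 - conj (Λ n) * z‖ ^ 2) *
          (Real.exp (2 * L) * Real.exp (-(G n z).re)) := by gcongr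
      _ = _ := by rw [hCdef]; ring
  refine ⟨C, hCpos, K, fun n => ?_, fun n => ?_, fun n k hkn => ?_, fun n z hz => ?_,
    fun z hz J => ?_⟩
  · refine (((hBd n).div_const _).mul (DifferentiableOn.pow ?_ 2)).mul
      (DifferentiableOn.cexp ((hGd n).const_sub _))
    refine DifferentiableOn.div (by fun_prop) (by fun_prop) fun z hz => ?_
    exact one_sub_conj_mul_ne_zero (hΛ n) (by simpa using hz)
  · have h : ((1 - ‖Λ n‖ ^ 2 : ℝ) : ℂ) = 1 - conj (Λ n) * Λ n := by
      rw [← Complex.normSq_eq_conj_mul_self, Complex.normSq_eq_norm_sq]; simp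
    simp only [hK, h, sub_self, Complex.exp_zero, mul_one, div_self (hBne n),
      div_self (one_sub_conj_mul_ne_zero (hΛ n) (hΛ n)), one_pow]
  · simp [hK, hB0 n k hkn]
  · refine (hKle n z hz).trans ?_
    have h0 : 0 ≤ (G n z).re := by simpa using hGsum n z hz ∅
    have hn := one_sub_norm_sq_pos (hΛ n)
    have : Real.exp (-(G n z).re) ≤ 1 := Real.exp_le_one_iff.2 (by linarith)
    gcongr
    exact mul_le_of_le_one_right (by positivity) this
  · have hz1 : ‖z‖ < 1 := by simpa using hz
    set a : ℕ → ℝ := fun k => (1 - ‖Λ k‖ ^ 2) * (cayleyKernel (Λ k) z).re with ha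
    have hKa : ∀ n ∈ J, ‖K n z‖ ≤
        C * (a n * Real.exp (-∑ k ∈ J with ‖Λ n‖ ≤ ‖Λ k‖, a k)) := by
      intro n _
      refine (hKle n z hz).trans ?_
      have hn := one_sub_norm_sq_pos (hΛ n)
      have han : (1 - ‖Λ n‖ ^ 2) ^ 2 / ‖1 - conj (Λ n) * z‖ ^ 2 ≤ a n := by
        simp only [ha]
        rw [cayleyKernel_re, ← mul_div_assoc, sq (1 - ‖Λ n‖ ^ 2)]
        gcongr
        exact mul_le_of_le_one_right (by positivity) (by nlinarith [norm_nonneg z])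
      have h0 := hterm z hz n
      have := hGsum n z hz J
      gcongr
    calc _ ≤ ∑ n ∈ J, C * (a n * Real.exp (-∑ k ∈ J with ‖Λ n‖ ≤ ‖Λ k‖, a k)) :=
          Finset.sum_le_sum hKa
      _ = C * ∑ n ∈ J, a n * Real.exp (-∑ k ∈ J with ‖Λ n‖ ≤ ‖Λ k‖, a k) := by
          rw [Finset.mul_sum]
      _ ≤ C * (1 - Real.exp (-∑ k ∈ J, a k)) := by
          gcongr
          exact sum_mul_exp_neg_sum_le (fun k => ‖Λ k‖) a (hterm z hz) J
      _ ≤ C := by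
          have := Real.exp_pos (-∑ k ∈ J, a k)
          nlinarith

lemma circle_integrand_continuous {f : ℂ → ℂ} (hf : ContinuousOn f (ball 0 1)) {r : ℝ}
    (hr : 0 < r) (hr1 : r < 1) :
    Continuous fun t : ℝ => f ((r : ℂ) * Complex.exp ((t : ℂ) * Complex.I)) := by
  refine hf.comp_continuous (by fun_prop) fun t => ?_
  simpa [Complex.norm_exp_ofReal_mul_I, abs_of_pos hr] using hr1

lemma norm_mul_exp_mul_I {r : ℝ} (hr : 0 < r) (t : ℝ) :
    ‖(r : ℂ) * Complex.exp ((t : ℂ) * Complex.I)‖ = r := by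
  simp [Complex.norm_exp_ofReal_mul_I, abs_of_pos hr]

lemma circle_mean_poisson_le {w : ℂ} (hw : ‖w‖ < 1) {r : ℝ} (hr : 0 < r) (hr1 : r < 1) :
    (1 / (2 * Real.pi)) * ∫ t in (0 : ℝ)..(2 * Real.pi), (1 - ‖w‖ ^ 2) /
      ‖1 - conj w * ((r : ℂ) * Complex.exp ((t : ℂ) * Complex.I))‖ ^ 2 ≤ 1 := by
  have hcont := circle_integrand_continuous (differentiableOn_cayleyKernel hw).continuousOn hr hr1
  have hmean : (1 / (2 * Real.pi)) * ∫ t in (0 : ℝ)..(2 * Real.pi),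
      (cayleyKernel w ((r : ℂ) * Complex.exp ((t : ℂ) * Complex.I))).re = 1 := by
    have h1 : Real.circleAverage (cayleyKernel w) 0 r = cayleyKernel w 0 := by
      refine DiffContOnCl.circleAverage ?_
      refine DifferentiableOn.diffContOnCl_ball (U := ball 0 1)
        (differentiableOn_cayleyKernel hw) ?_
      exact closedBall_subset_ball (by rwa [abs_of_pos hr])
    have h2 : cayleyKernel w 0 = 1 := by simp [cayleyKernel]
    rw [h2, Real.circleAverage] at h1
    have h3 := congrArg Complex.re h1
    rw [Complex.smul_re, smul_eq_mul] at h3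
    have h4 := Complex.reCLM.intervalIntegral_comp_comm
      (hcont.intervalIntegrable (μ := volume) 0 (2 * Real.pi))
    simp only [Complex.reCLM_apply] at h4
    rw [h4, one_div]
    simpa [circleMap] using h3
  refine le_trans ?_ hmean.le
  refine mul_le_mul_of_nonneg_left ?_ (by positivity)
  refine intervalIntegral.integral_mono_on Real.two_pi_pos.le ?_ ?_ fun t _ => ?_
  · refine Continuous.intervalIntegrable ?_ _ _
    refine continuous_const.div (by fun_prop) fun t => ?_
    exact pow_ne_zero 2 (norm_one_sub_conj_mul_pos hw
      ((norm_mul_exp_mul_I hr t).trans_lt hr1)).ne'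
  · exact (Complex.continuous_re.comp hcont).intervalIntegrable _ _
  · rw [cayleyKernel_re, norm_mul_exp_mul_I hr]
    gcongr
    have : r ^ 2 ≤ 1 := by nlinarith
    nlinarith [sq_nonneg ‖w‖]

lemma memHardy2_tsum {Λ : ℕ → ℂ} (hΛ : ∀ n, ‖Λ n‖ < 1) {h : ℕ → ℂ → ℂ} {c : ℕ → ℝ}
    (hd : ∀ n, DifferentiableOn ℂ (h n) (ball 0 1))
    (hbd : ∀ r : ℝ, 0 < r → r < 1 → ∃ u : ℕ → ℝ, Summable u ∧ ∀ n, ∀ z : ℂ, ‖z‖ ≤ r →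
      ‖h n z‖ ≤ u n)
    (hc : ∀ n, 0 ≤ c n) (hcs : Summable c)
    (hle : ∀ z ∈ ball (0 : ℂ) 1, ∀ J : Finset ℕ, ‖∑ n ∈ J, h n z‖ ^ 2 ≤
      ∑ n ∈ J, c n * ((1 - ‖Λ n‖ ^ 2) / ‖1 - conj (Λ n) * z‖ ^ 2)) :
    MemHardy2 fun z => ∑' n, h n z := by
  refine ⟨?_, ∑' n, c n, fun r hr hr1 => ?_⟩
  · refine differentiableOn_ball_of_forall_lt fun r hr hr1 => ?_
    obtain ⟨u, hu, hhu⟩ := hbd r hr hr1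
    exact Complex.differentiableOn_tsum_of_summable_norm hu
      (fun n => (hd n).mono (ball_subset_ball hr1.le)) isOpen_ball
      fun n z hz => hhu n z (mem_ball_zero_iff.1 hz).le
  · obtain ⟨u, hu, hhu⟩ := hbd r hr hr1
    set e : ℝ → ℂ := fun t => (r : ℂ) * Complex.exp ((t : ℂ) * Complex.I) with he
    have hen : ∀ t, ‖e t‖ = r := norm_mul_exp_mul_I hr
    have hemem : ∀ t, e t ∈ ball (0 : ℂ) 1 := fun t => by simpa [hen t] using hr1
    have hu0 : ∀ n, 0 ≤ u n := fun n => (norm_nonneg _).trans (hhu n (e 0) (hen 0).le)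
    have hcont : ∀ n, Continuous fun t => h n (e t) := fun n =>
      circle_integrand_continuous (hd n).continuousOn hr hr1
    have hlim : Tendsto (fun J : Finset ℕ => (1 / (2 * Real.pi)) *
        ∫ t in (0 : ℝ)..(2 * Real.pi), ‖∑ n ∈ J, h n (e t)‖ ^ 2) atTop
        (𝓝 ((1 / (2 * Real.pi)) * ∫ t in (0 : ℝ)..(2 * Real.pi), ‖∑' n, h n (e t)‖ ^ 2)) := by
      refine Tendsto.const_mul _ ?_
      refine intervalIntegral.tendsto_integral_filter_of_dominated_convergence
        (fun _ => (∑' n, u n) ^ 2) (Eventually.of_forall fun J => ?_)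
        (Eventually.of_forall fun J => Eventually.of_forall fun t _ => ?_) ?_
        (Eventually.of_forall fun t _ => ?_)
      · have : Continuous fun t => ‖∑ n ∈ J, h n (e t)‖ ^ 2 :=
          ((continuous_finsetSum J fun n _ => hcont n).norm).pow 2
        exact this.aestronglyMeasurable
      · rw [norm_pow, norm_norm]
        gcongr
        refine (norm_sum_le _ _).trans ?_
        exact (Finset.sum_le_sum fun n _ => hhu n (e t) (hen t).le).trans
          (hu.sum_le_tsum J fun n _ => hu0 n)
      · exact intervalIntegrable_const
      · have hs : Summable fun n => h n (e t) :=
          hu.of_norm_bounded fun n => hhu n (e t) (hen t).le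
        exact (hs.hasSum.norm).pow 2
    refine le_of_tendsto hlim (Eventually.of_forall fun J => ?_)
    have hker : ∀ n, Continuous fun t => (1 - ‖Λ n‖ ^ 2) / ‖1 - conj (Λ n) * e t‖ ^ 2 := by
      intro n
      refine continuous_const.div (by fun_prop) fun t => ?_
      have := norm_one_sub_conj_mul_pos (hΛ n) ((hen t).trans_lt hr1)
      positivity
    calc (1 / (2 * Real.pi)) * ∫ t in (0 : ℝ)..(2 * Real.pi), ‖∑ n ∈ J, h n (e t)‖ ^ 2
        ≤ (1 / (2 * Real.pi)) * ∫ t in (0 : ℝ)..(2 * Real.pi),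
          ∑ n ∈ J, c n * ((1 - ‖Λ n‖ ^ 2) / ‖1 - conj (Λ n) * e t‖ ^ 2) := by
          gcongr ?_ * ?_
          refine intervalIntegral.integral_mono_on (by positivity) ?_ ?_
            fun t _ => hle (e t) (hemem t) J
          · exact (((continuous_finsetSum J fun n _ => hcont n).norm).pow 2).intervalIntegrable _ _
          · exact (continuous_finsetSum J fun n _ =>
              (hker n).const_mul (c n)).intervalIntegrable _ _
      _ = ∑ n ∈ J, c n * ((1 / (2 * Real.pi)) * ∫ t in (0 : ℝ)..(2 * Real.pi),
          (1 - ‖Λ n‖ ^ 2) / ‖1 - conj (Λ n) * e t‖ ^ 2) := by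
          rw [intervalIntegral.integral_finsetSum fun n _ =>
            ((hker n).const_mul (c n)).intervalIntegrable _ _, Finset.mul_sum]
          refine Finset.sum_congr rfl fun n _ => ?_
          rw [intervalIntegral.integral_const_mul]
          ring
      _ ≤ ∑ n ∈ J, c n := by
          refine Finset.sum_le_sum fun n _ => ?_
          exact mul_le_of_le_one_right (hc n) (circle_mean_poisson_le (hΛ n) hr hr1)
      _ ≤ ∑' n, c n := hcs.sum_le_tsum J fun n _ => hc n

lemma MemHardy2.add {f g : ℂ → ℂ} (hf : MemHardy2 f) (hg : MemHardy2 g) :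
    MemHardy2 fun z => f z + g z := by
  obtain ⟨hfd, A, hA⟩ := hf
  obtain ⟨hgd, B, hB⟩ := hg
  refine ⟨hfd.add hgd, 2 * A + 2 * B, fun r hr hr1 => ?_⟩
  have cf : Continuous fun t : ℝ => ‖f ((r : ℂ) * Complex.exp ((t : ℂ) * Complex.I))‖ ^ 2 :=
    (circle_integrand_continuous hfd.continuousOn hr hr1).norm.pow 2
  have cg : Continuous fun t : ℝ => ‖g ((r : ℂ) * Complex.exp ((t : ℂ) * Complex.I))‖ ^ 2 :=
    (circle_integrand_continuous hgd.continuousOn hr hr1).norm.pow 2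
  have cfg : Continuous fun t : ℝ => ‖f ((r : ℂ) * Complex.exp ((t : ℂ) * Complex.I)) +
      g ((r : ℂ) * Complex.exp ((t : ℂ) * Complex.I))‖ ^ 2 :=
    (circle_integrand_continuous (hfd.add hgd).continuousOn hr hr1).norm.pow 2
  have h := intervalIntegral.integral_mono_on (a := 0) (b := 2 * Real.pi) (by positivity)
    (cfg.intervalIntegrable (μ := volume) _ _)
    (((cf.const_mul 2).fun_add (cg.const_mul 2)).intervalIntegrable (μ := volume) _ _) fun t _ => by
      set z := (r : ℂ) * Complex.exp ((t : ℂ) * Complex.I)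
      have h1 := norm_add_le (f z) (g z)
      have h2 : ‖f z + g z‖ ^ 2 ≤ (‖f z‖ + ‖g z‖) ^ 2 := by gcongr
      change ‖f z + g z‖ ^ 2 ≤ 2 * ‖f z‖ ^ 2 + 2 * ‖g z‖ ^ 2
      nlinarith [sq_nonneg (‖f z‖ - ‖g z‖)]
  rw [intervalIntegral.integral_add ((cf.const_mul 2).intervalIntegrable _ _)
    ((cg.const_mul 2).intervalIntegrable _ _), intervalIntegral.integral_const_mul,
    intervalIntegral.integral_const_mul] at h
  have h' := mul_le_mul_of_nonneg_left h (by positivity : 0 ≤ 1 / (2 * Real.pi))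
  refine h'.trans ?_
  linarith [hA r hr hr1, hB r hr hr1]

lemma MemHardy2.bounded_mul {φ f : ℂ → ℂ} (hf : MemHardy2 f)
    (hφ : DifferentiableOn ℂ φ (ball 0 1)) {M : ℝ} (hM : ∀ z ∈ ball (0 : ℂ) 1, ‖φ z‖ ≤ M) :
    MemHardy2 fun z => φ z * f z := by
  obtain ⟨hfd, A, hA⟩ := hf
  refine ⟨hφ.mul hfd, M ^ 2 * A, fun r hr hr1 => ?_⟩
  have cf : Continuous fun t : ℝ => ‖f ((r : ℂ) * Complex.exp ((t : ℂ) * Complex.I))‖ ^ 2 :=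
    (circle_integrand_continuous hfd.continuousOn hr hr1).norm.pow 2
  have cfg : Continuous fun t : ℝ => ‖φ ((r : ℂ) * Complex.exp ((t : ℂ) * Complex.I)) *
      f ((r : ℂ) * Complex.exp ((t : ℂ) * Complex.I))‖ ^ 2 :=
    (circle_integrand_continuous (hφ.mul hfd).continuousOn hr hr1).norm.pow 2
  have h := intervalIntegral.integral_mono_on (a := 0) (b := 2 * Real.pi) (by positivity)
    (cfg.intervalIntegrable (μ := volume) _ _)
    ((cf.const_mul (M ^ 2)).intervalIntegrable (μ := volume) _ _) fun t _ => by
      have hz := norm_mul_exp_mul_I hr t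
      set z := (r : ℂ) * Complex.exp ((t : ℂ) * Complex.I)
      have := hM z (by simpa [hz] using hr1)
      change ‖φ z * f z‖ ^ 2 ≤ M ^ 2 * ‖f z‖ ^ 2
      rw [norm_mul, mul_pow]
      gcongr
  rw [intervalIntegral.integral_const_mul] at h
  have h' := mul_le_mul_of_nonneg_left h (by positivity : 0 ≤ 1 / (2 * Real.pi))
  refine h'.trans ?_
  have := mul_le_mul_of_nonneg_left (hA r hr hr1) (sq_nonneg M)
  linarith

lemma exists_forall_norm_polynomial_eval_le (p : Polynomial ℂ) :
    ∃ M : ℝ, ∀ z ∈ ball (0 : ℂ) 1, ‖p.eval z‖ ≤ M := by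
  obtain ⟨M, hM⟩ := (isCompact_closedBall (0 : ℂ) 1).exists_bound_of_continuousOn
    p.continuous.continuousOn
  exact ⟨M, fun z hz => hM z (ball_subset_closedBall hz)⟩

/-- A bounded function in `∏ (z - ζ j)^(m j) H²` is a multiplier of `H(b)`. -/
lemma MemHb.mul_of_bounded {l : ℕ} {ζ : Fin l → ℂ} {m : Fin l → ℕ} {F g f : ℂ → ℂ}
    (hg : MemHardy2 g) (hF : ∀ z ∈ ball (0 : ℂ) 1, F z = (∏ j, (z - ζ j) ^ m j) * g z) {M : ℝ}
    (hM : ∀ z ∈ ball (0 : ℂ) 1, ‖F z‖ ≤ M) (hf : MemHb ζ m f) :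
    MemHb ζ m fun z => F z * f z := by
  obtain ⟨h, p, hh, -, hf⟩ := hf
  have hFd : DifferentiableOn ℂ F (ball 0 1) := by
    have : DifferentiableOn ℂ (fun z : ℂ => ∏ j, (z - ζ j) ^ m j) (ball 0 1) := by fun_prop
    exact (this.mul hg.1).congr hF
  obtain ⟨A, hA⟩ := exists_forall_norm_polynomial_eval_le p
  refine ⟨fun z => F z * h z + p.eval z * g z, 0, (hh.bounded_mul hFd hM).add
    (hg.bounded_mul p.differentiable.differentiableOn hA), ?_, fun z hz => ?_⟩
  · rw [Polynomial.degree_zero]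
    exact WithBot.bot_lt_coe _
  · simp only [hf z hz, Polynomial.eval_zero]
    linear_combination (p.eval z) * hF z hz

section Damping

lemma norm_sq_eq_re_sq_add_im_sq (z : ℂ) : ‖z‖ ^ 2 = z.re ^ 2 + z.im ^ 2 := by
  rw [← Complex.normSq_eq_norm_sq, Complex.normSq_apply]
  ring

lemma norm_sub_le_norm_sub_one_add_mul {ξ z : ℂ} (hξ : ‖ξ‖ = 1) (hz : ‖z‖ ≤ 1) {ε : ℝ}
    (hε : 0 ≤ ε) : ‖z - ξ‖ ≤ ‖z - (1 + ε) * ξ‖ ∧ ε ≤ ‖z - (1 + ε) * ξ‖ := by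
  constructor
  · refine le_of_sq_le_sq ?_ (norm_nonneg _)
    have h1 : ξ.re ^ 2 + ξ.im ^ 2 = 1 := by
      rw [← norm_sq_eq_re_sq_add_im_sq, hξ]; norm_num
    have h2 : z.re ^ 2 + z.im ^ 2 ≤ 1 := by
      rw [← norm_sq_eq_re_sq_add_im_sq]; nlinarith [norm_nonneg z]
    simp only [norm_sq_eq_re_sq_add_im_sq]
    simp only [Complex.sub_re, Complex.sub_im, Complex.mul_re, Complex.mul_im, Complex.add_re,
      Complex.add_im, Complex.one_re, Complex.one_im, Complex.ofReal_re, Complex.ofReal_im]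
    have h3 : z.re * ξ.re + z.im * ξ.im ≤ 1 := by
      nlinarith [sq_nonneg (z.re - ξ.re), sq_nonneg (z.im - ξ.im)]
    nlinarith [mul_nonneg hε (sub_nonneg.2 h3), sq_nonneg ε]
  · have h := norm_sub_norm_le ((1 + ε) * ξ) z
    have h1 : ‖(1 + (ε : ℂ)) * ξ‖ = 1 + ε := by
      rw [norm_mul, hξ, mul_one, ← Complex.ofReal_one, ← Complex.ofReal_add, Complex.norm_real,
        Real.norm_of_nonneg (by linarith)]
    rw [norm_sub_rev] at h
    linarith

/-- A function `p`, holomorphic on the disk and of size at most `2 / |ξ - w|`, such that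
`(z - ξ) p(z)` is bounded by `2` and equal to `1` at `w`. -/
lemma exists_dampingFactor {ξ w : ℂ} (hξ : ‖ξ‖ = 1) (hw : ‖w‖ < 1) :
    ∃ p : ℂ → ℂ, DifferentiableOn ℂ p (ball 0 1) ∧ (w - ξ) * p w = 1 ∧
      (∀ z ∈ ball (0 : ℂ) 1, ‖(z - ξ) * p z‖ ≤ 2) ∧
      ∀ z ∈ ball (0 : ℂ) 1, ‖p z‖ ≤ 2 * ‖ξ - w‖⁻¹ := by
  have hne : w - ξ ≠ 0 := by
    intro h
    rw [sub_eq_zero.1 h, hξ] at hw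
    exact lt_irrefl _ hw
  set ε : ℝ := ‖ξ - w‖ with hε
  have hε' : ‖w - ξ‖ = ε := norm_sub_rev _ _
  have hεpos : 0 < ε := by rw [← hε']; exact norm_pos_iff.2 hne
  have key : ∀ z ∈ ball (0 : ℂ) 1, ‖z - ξ‖ ≤ ‖z - (1 + ε) * ξ‖ ∧ ε ≤ ‖z - (1 + ε) * ξ‖ :=
    fun z hz => norm_sub_le_norm_sub_one_add_mul hξ (mem_ball_zero_iff.1 hz).le hεpos.le
  have hpos : ∀ z ∈ ball (0 : ℂ) 1, 0 < ‖z - (1 + ε) * ξ‖ :=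
    fun z hz => hεpos.trans_le (key z hz).2
  have hcoef : ‖(w - (1 + ε) * ξ) / (w - ξ)‖ ≤ 2 := by
    rw [norm_div, hε', div_le_iff₀ hεpos]
    have h1 : w - (1 + ε) * ξ = (w - ξ) - ε * ξ := by ring
    rw [h1]
    refine (norm_sub_le _ _).trans ?_
    rw [hε', norm_mul, hξ, Complex.norm_real, Real.norm_of_nonneg hεpos.le]
    linarith
  refine ⟨fun z => (w - (1 + ε) * ξ) / (w - ξ) * (z - (1 + ε) * ξ)⁻¹, ?_, ?_, fun z hz => ?_,
    fun z hz => ?_⟩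
  · refine DifferentiableOn.const_mul (DifferentiableOn.fun_inv (by fun_prop) fun z hz => ?_) _
    exact norm_pos_iff.1 (hpos z hz)
  · have := norm_pos_iff.1 (hpos w (by simpa using hw))
    rw [← mul_assoc, mul_div_cancel₀ _ hne, mul_inv_cancel₀ this]
  · rw [mul_left_comm, norm_mul, norm_mul, norm_inv, ← div_eq_mul_inv]
    have : ‖z - ξ‖ / ‖z - (1 + ε) * ξ‖ ≤ 1 := div_le_one_of_le₀ (key z hz).1 (norm_nonneg _)
    calc _ ≤ (2 : ℝ) * 1 := by gcongr
      _ = 2 := mul_one _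
  · rw [norm_mul, norm_inv]
    have := (key z hz).2
    gcongr

lemma summable_mul_prod_inv {l : ℕ} {ζ : Fin l → ℂ} {m : Fin l → ℕ}
    (hζinj : Function.Injective ζ) {Λ : ℕ → ℂ} {s : ℕ → ℝ}
    (hne : ∀ j n, Λ n ≠ ζ j) (hs0 : ∀ n, 0 ≤ s n) (hs : Summable s)
    (hsum : ∀ j, Summable fun n => s n / ‖ζ j - Λ n‖ ^ (2 * m j)) (S : Finset (Fin l)) :
    Summable fun n => s n * ∏ j ∈ S, (‖ζ j - Λ n‖ ^ (2 * m j))⁻¹ := by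
  have hpos : ∀ j n, 0 < ‖ζ j - Λ n‖ := fun j n =>
    norm_pos_iff.2 (sub_ne_zero.2 (hne j n).symm)
  obtain ⟨η, hη, hsep⟩ : ∃ η : ℝ, 0 < η ∧ ∀ i j, i ≠ j → 2 * η < ‖ζ i - ζ j‖ := by
    have h : ∀ᶠ η : ℝ in 𝓝[>] 0, ∀ i j, i ≠ j → 2 * η < ‖ζ i - ζ j‖ := by
      refine eventually_all.2 fun i => eventually_all.2 fun j => ?_
      by_cases hij : i = j
      · simp [hij]
      have hd : 0 < ‖ζ i - ζ j‖ := norm_pos_iff.2 (sub_ne_zero.2 (hζinj.ne hij))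
      have : Tendsto (fun η : ℝ => 2 * η) (𝓝[>] 0) (𝓝 0) := by
        refine tendsto_nhdsWithin_of_tendsto_nhds ?_
        exact (continuous_const.mul continuous_id).tendsto' _ _ (by simp)
      filter_upwards [this.eventually_lt_const hd] with η hη _ using hη
    obtain ⟨η, h1, h2⟩ := (h.and self_mem_nhdsWithin).exists
    exact ⟨η, h2, h1⟩
  induction S using Finset.induction_on with
  | empty => simpa using hs
  | insert i S hi ih =>
    set A : ℝ := (η ^ (2 * m i))⁻¹
    set A' : ℝ := ∏ j ∈ S, (η ^ (2 * m j))⁻¹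
    refine Summable.of_nonneg_of_le (fun n => ?_) (fun n => ?_)
      ((ih.mul_left A).add ((hsum i).mul_left A'))
    · exact mul_nonneg (hs0 n) (Finset.prod_nonneg fun j _ => by positivity)
    · rw [Finset.prod_insert hi]
      have hP : 0 ≤ ∏ j ∈ S, (‖ζ j - Λ n‖ ^ (2 * m j))⁻¹ :=
        Finset.prod_nonneg fun j _ => by positivity
      have hA : 0 ≤ A := by positivity
      have hA' : 0 ≤ A' := Finset.prod_nonneg fun j _ => by positivity
      have hsn := hs0 n
      have hx := hpos i n
      rw [div_eq_mul_inv]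
      rcases le_or_gt η ‖ζ i - Λ n‖ with h | h
      · have h1 : (‖ζ i - Λ n‖ ^ (2 * m i))⁻¹ ≤ A := by
          simp only [A]; gcongr
        have h2 := mul_le_mul_of_nonneg_left
          (mul_le_mul_of_nonneg_right h1 hP) hsn
        have h3 : 0 ≤ A' * (s n * (‖ζ i - Λ n‖ ^ (2 * m i))⁻¹) := by positivity
        linarith
      · have h1 : ∏ j ∈ S, (‖ζ j - Λ n‖ ^ (2 * m j))⁻¹ ≤ A' := by
          refine Finset.prod_le_prod (fun j _ => by positivity) fun j hj => ?_
          have hij : i ≠ j := fun e => hi (e ▸ hj)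
          have h4 := norm_sub_le_norm_sub_add_norm_sub (ζ i) (Λ n) (ζ j)
          rw [norm_sub_rev (Λ n)] at h4
          have h5 := hsep i j hij
          have : η ≤ ‖ζ j - Λ n‖ := by linarith
          gcongr
        have h2 := mul_le_mul_of_nonneg_left
          (mul_le_mul_of_nonneg_left h1 (by positivity : 0 ≤ (‖ζ i - Λ n‖ ^ (2 * m i))⁻¹)) hsn
        have h3 : 0 ≤ A * (s n * ∏ j ∈ S, (‖ζ j - Λ n‖ ^ (2 * m j))⁻¹) := by positivity
        linarith

/-- Functions `u n` of controlled growth such that `∏ (z - ζ j)^(m j) u n` is bounded and equal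
to `1` at `Λ n`. -/
lemma exists_damping {l : ℕ} {ζ : Fin l → ℂ} {m : Fin l → ℕ} (hζ : ∀ j, ‖ζ j‖ = 1)
    (hζinj : Function.Injective ζ) {Λ : ℕ → ℂ} (hΛ : ∀ n, ‖Λ n‖ < 1)
    (hs : Summable fun n => 1 - ‖Λ n‖ ^ 2)
    (hsum : ∀ j, Summable fun n => (1 - ‖Λ n‖ ^ 2) / ‖ζ j - Λ n‖ ^ (2 * m j)) :
    ∃ D : ℝ, 0 < D ∧ ∃ (u : ℕ → ℂ → ℂ) (d : ℕ → ℝ),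
      (∀ n, DifferentiableOn ℂ (u n) (ball 0 1)) ∧
      (∀ n, (∏ j, (Λ n - ζ j) ^ m j) * u n (Λ n) = 1) ∧
      (∀ n, ∀ z ∈ ball (0 : ℂ) 1, ‖(∏ j, (z - ζ j) ^ m j) * u n z‖ ≤ D) ∧
      (∀ n, ∀ z ∈ ball (0 : ℂ) 1, ‖u n z‖ ≤ d n) ∧
      Summable fun n => (1 - ‖Λ n‖ ^ 2) * d n ^ 2 := by
  choose p hpd hp1 hp2 hpb using fun j n => exists_dampingFactor (hζ j) (hΛ n)
  set D : ℝ := ∏ j, 2 ^ m j with hD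
  have hDpos : 0 < D := Finset.prod_pos fun j _ => by positivity
  refine ⟨D, hDpos, fun n z => ∏ j, p j n z ^ m j,
    fun n => D * ∏ j, (‖ζ j - Λ n‖⁻¹) ^ m j, fun n => ?_, fun n => ?_, fun n z hz => ?_,
    fun n z hz => ?_, ?_⟩
  · exact DifferentiableOn.fun_finsetProd fun j _ => (hpd j n).fun_pow _
  · rw [← Finset.prod_mul_distrib]
    refine Finset.prod_eq_one fun j _ => ?_
    rw [← mul_pow, hp1, one_pow]
  · rw [← Finset.prod_mul_distrib, norm_prod]
    refine Finset.prod_le_prod (fun _ _ => norm_nonneg _) fun j _ => ?_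
    rw [← mul_pow, norm_pow]
    have := hp2 j n z hz
    gcongr
  · simp only [hD]
    rw [norm_prod, ← Finset.prod_mul_distrib]
    refine Finset.prod_le_prod (fun _ _ => norm_nonneg _) fun j _ => ?_
    rw [← mul_pow, norm_pow]
    have := hpb j n z hz
    gcongr
  · have hne : ∀ j n, Λ n ≠ ζ j := by
      intro j n h
      have := hΛ n
      rw [h, hζ j] at this
      exact lt_irrefl _ this
    have h := summable_mul_prod_inv hζinj hne (fun n => (one_sub_norm_sq_pos (hΛ n)).le) hs hsum
      Finset.univ
    refine (h.mul_left (D ^ 2)).congr fun n => ?_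
    have : ∏ j, (‖ζ j - Λ n‖ ^ (2 * m j))⁻¹ = (∏ j, (‖ζ j - Λ n‖⁻¹) ^ m j) ^ 2 := by
      rw [← Finset.prod_pow]
      refine Finset.prod_congr rfl fun j _ => ?_
      rw [← pow_mul, inv_pow, mul_comm (m j)]
    rw [this]
    ring

end Damping

/-- Interpolation of a bounded sequence by `W · g` from kernels `K n` and damping functions
`u n`. -/
lemma exists_interpolant {Λ : ℕ → ℂ} (hΛ : ∀ n, ‖Λ n‖ < 1)
    (hs : Summable fun n => 1 - ‖Λ n‖ ^ 2) {W : ℂ → ℂ} {K u : ℕ → ℂ → ℂ} {d : ℕ → ℝ}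
    {C D M : ℝ} (hC : 0 ≤ C)
    (hKd : ∀ n, DifferentiableOn ℂ (K n) (ball 0 1)) (hK1 : ∀ n, K n (Λ n) = 1)
    (hK0 : ∀ n k, k ≠ n → K n (Λ k) = 0)
    (hKle : ∀ n, ∀ z ∈ ball (0 : ℂ) 1,
      ‖K n z‖ ≤ C * ((1 - ‖Λ n‖ ^ 2) ^ 2 / ‖1 - conj (Λ n) * z‖ ^ 2))
    (hKsum : ∀ z ∈ ball (0 : ℂ) 1, ∀ J : Finset ℕ, ∑ n ∈ J, ‖K n z‖ ≤ C) (hD : 0 ≤ D)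
    (hud : ∀ n, DifferentiableOn ℂ (u n) (ball 0 1)) (hu1 : ∀ n, W (Λ n) * u n (Λ n) = 1)
    (huD : ∀ n, ∀ z ∈ ball (0 : ℂ) 1, ‖W z * u n z‖ ≤ D)
    (hule : ∀ n, ∀ z ∈ ball (0 : ℂ) 1, ‖u n z‖ ≤ d n)
    (hds : Summable fun n => (1 - ‖Λ n‖ ^ 2) * d n ^ 2) {v : ℕ → ℂ} (hv : ∀ n, ‖v n‖ ≤ M) :
    ∃ (F g : ℂ → ℂ), MemHardy2 g ∧ (∀ z ∈ ball (0 : ℂ) 1, F z = W z * g z) ∧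
      (∃ C : ℝ, ∀ z ∈ ball (0 : ℂ) 1, ‖F z‖ ≤ C) ∧ ∀ n, F (Λ n) = v n := by
  have hM : 0 ≤ M := (norm_nonneg _).trans (hv 0)
  have hd0 : ∀ n, 0 ≤ d n := fun n => (norm_nonneg _).trans (hule n 0 (by simp))
  have hspos : ∀ n, 0 < 1 - ‖Λ n‖ ^ 2 := fun n => one_sub_norm_sq_pos (hΛ n)
  set h : ℕ → ℂ → ℂ := fun n z => v n * (K n z * u n z) with hh
  have hg : MemHardy2 fun z => ∑' n, h n z := by
    refine memHardy2_tsum (c := fun n => M ^ 2 * C ^ 2 * ((1 - ‖Λ n‖ ^ 2) * d n ^ 2)) hΛ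
      (fun n => ((hKd n).mul (hud n)).const_mul _) (fun r hr hr1 => ?_) (fun n => ?_)
      (hds.mul_left _) fun z hz J => ?_
    · have hr' : 0 < 1 - r := by linarith
      refine ⟨fun n => M * (C * ((1 - ‖Λ n‖ ^ 2) ^ 2 / (1 - r) ^ 2)) * d n, ?_,
        fun n z hz => ?_⟩
      · refine Summable.of_nonneg_of_le (fun n => ?_) (fun n => ?_)
          ((hs.add hds).mul_left (M * C / (1 - r) ^ 2))
        · have := hd0 n
          positivity
        · have h1 : (1 - ‖Λ n‖ ^ 2) ^ 2 * d n ≤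
              (1 - ‖Λ n‖ ^ 2) + (1 - ‖Λ n‖ ^ 2) * d n ^ 2 := by
            have h2 : (1 - ‖Λ n‖ ^ 2) ^ 2 ≤ 1 - ‖Λ n‖ ^ 2 := by
              nlinarith [hspos n, one_sub_norm_sq_le_one (Λ n)]
            have h3 : d n ≤ 1 + d n ^ 2 := by nlinarith [sq_nonneg (d n - 1), hd0 n]
            calc _ ≤ (1 - ‖Λ n‖ ^ 2) * (1 + d n ^ 2) := by
                  have := hspos n
                  have := hd0 n
                  gcongr
              _ = _ := by ring
          calc _ = M * C / (1 - r) ^ 2 * ((1 - ‖Λ n‖ ^ 2) ^ 2 * d n) := by ring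
            _ ≤ _ := by gcongr
      · have hz1 : z ∈ ball (0 : ℂ) 1 := by simpa using hz.trans_lt hr1
        have h1 : 1 - r ≤ ‖1 - conj (Λ n) * z‖ := by
          linarith [one_sub_norm_le_norm_one_sub_conj_mul (hΛ n) z]
        have h2 : ‖K n z‖ ≤ C * ((1 - ‖Λ n‖ ^ 2) ^ 2 / (1 - r) ^ 2) :=
          (hKle n z hz1).trans (by gcongr)
        simp only [hh, norm_mul]
        rw [← mul_assoc]
        have := hule n z hz1
        have := hv n
        gcongr
    · have := hspos n
      positivity
    · have h1 : ‖∑ n ∈ J, h n z‖ ≤ M * ∑ n ∈ J, ‖K n z‖ * d n := by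
        rw [Finset.mul_sum]
        refine (norm_sum_le _ _).trans (Finset.sum_le_sum fun n _ => ?_)
        simp only [hh, norm_mul]
        have := hule n z hz
        have := hv n
        gcongr
      have h2 : (∑ n ∈ J, ‖K n z‖ * d n) ^ 2 ≤
          (∑ n ∈ J, ‖K n z‖) * ∑ n ∈ J, ‖K n z‖ * d n ^ 2 :=
        Finset.sum_sq_le_sum_mul_sum_of_sq_le_mul J (fun n _ => norm_nonneg _)
          (fun n _ => by positivity) fun n _ => le_of_eq (by ring)
      calc ‖∑ n ∈ J, h n z‖ ^ 2 ≤ (M * ∑ n ∈ J, ‖K n z‖ * d n) ^ 2 := by gcongr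
        _ = M ^ 2 * (∑ n ∈ J, ‖K n z‖ * d n) ^ 2 := by ring
        _ ≤ M ^ 2 * (C * ∑ n ∈ J, ‖K n z‖ * d n ^ 2) := by
            have h3 : 0 ≤ ∑ n ∈ J, ‖K n z‖ * d n ^ 2 :=
              Finset.sum_nonneg fun n _ => by positivity
            have := mul_le_mul_of_nonneg_right (hKsum z hz J) h3
            gcongr
            linarith
        _ ≤ M ^ 2 * (C * ∑ n ∈ J,
              C * ((1 - ‖Λ n‖ ^ 2) ^ 2 / ‖1 - conj (Λ n) * z‖ ^ 2) * d n ^ 2) := by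
            gcongr with n hn
            exact hKle n z hz
        _ = _ := by
            rw [Finset.mul_sum, Finset.mul_sum]
            refine Finset.sum_congr rfl fun n _ => ?_
            ring
  have hFle : ∀ z ∈ ball (0 : ℂ) 1, ∀ n, ‖W z * h n z‖ ≤ M * D * ‖K n z‖ := by
    intro z hz n
    have e : W z * h n z = v n * (W z * u n z) * K n z := by simp only [hh]; ring
    rw [e, norm_mul, norm_mul]
    have := huD n z hz
    have := hv n
    gcongr
  refine ⟨fun z => W z * ∑' n, h n z, _, hg, fun z _ => rfl, ⟨M * D * C, fun z hz => ?_⟩,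
    fun k => ?_⟩
  · have hKs : Summable fun n => ‖K n z‖ :=
      summable_of_sum_le (fun n => norm_nonneg _) (hKsum z hz)
    have hsum : Summable fun n => ‖W z * h n z‖ :=
      (hKs.mul_left (M * D)).of_nonneg_of_le (fun _ => norm_nonneg _) (hFle z hz)
    simp only
    rw [← tsum_mul_left]
    calc _ ≤ ∑' n, ‖W z * h n z‖ := norm_tsum_le_tsum_norm hsum
      _ ≤ ∑' n, M * D * ‖K n z‖ := hsum.tsum_le_tsum (hFle z hz) (hKs.mul_left _)
      _ = M * D * ∑' n, ‖K n z‖ := tsum_mul_left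
      _ ≤ M * D * C := by
          gcongr
          exact hKs.tsum_le_of_sum_le (hKsum z hz)
  · have h1 : ∑' n, h n (Λ k) = h k (Λ k) :=
      tsum_eq_single k fun n hn => by simp [hh, hK0 n k hn.symm]
    simp only [h1]
    simp only [hh, hK1]
    linear_combination v k * hu1 k

/-- **Lemma.** Let `b` be rational, non-inner, in the closed unit ball of `H^∞` with
`‖b‖_∞ = 1`, with Pythagorean mate `a` whose circle zeros are `ζ j` with multiplicities `m j`.
If `Λ ⊂ 𝔻` satisfies the Carleson condition and `∑_n (1-|Λ n|²)/|ζ j - Λ n|^{2 m j} < ∞` for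
every `j`, then for every bounded sequence `v` there are `F ∈ H^∞` and `g ∈ H²` with
`F = ∏ (z-ζ j)^{m j} · g` on `𝔻` (i.e. `F ∈ aH² ∩ H^∞`) and `F (Λ n) = v n` for all `n`;
in particular `Λ` is multiplier interpolating for `H(b)`. -/
theorem statement13
    (b a : ℂ → ℂ) (l : ℕ) (ζ : Fin l → ℂ) (m : Fin l → ℕ)
    (hζ : ∀ j, ‖ζ j‖ = 1) (hζinj : Function.Injective ζ) (hm : ∀ j, 1 ≤ m j)
    (hb_rat : ∃ P Q : Polynomial ℂ, (∀ z : ℂ, ‖z‖ ≤ 1 → Q.eval z ≠ 0) ∧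
      ∀ z : ℂ, ‖z‖ ≤ 1 → b z = P.eval z / Q.eval z)
    (hb_le : ∀ z : ℂ, ‖z‖ ≤ 1 → ‖b z‖ ≤ 1)
    (hb_norm : ∃ z : ℂ, ‖z‖ = 1 ∧ ‖b z‖ = 1)
    (hb_noninner : ∃ z : ℂ, ‖z‖ = 1 ∧ ‖b z‖ < 1)
    (ha_form : ∃ P Q : Polynomial ℂ, (∀ z : ℂ, ‖z‖ ≤ 1 → P.eval z ≠ 0 ∧ Q.eval z ≠ 0) ∧
      ∀ z : ℂ, ‖z‖ ≤ 1 → a z = (∏ j, (z - ζ j) ^ m j) * P.eval z / Q.eval z)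
    (ha_le : ∀ z : ℂ, ‖z‖ ≤ 1 → ‖a z‖ ≤ 1)
    (ha0 : 0 < (a 0).re ∧ (a 0).im = 0)
    (hab : ∀ z : ℂ, ‖z‖ = 1 → ‖a z‖ ^ 2 + ‖b z‖ ^ 2 = 1)
    (Λ : ℕ → ℂ) (hΛ : ∀ n, ‖Λ n‖ < 1)
    (hC : CarlesonCond Λ)
    (hsum : ∀ j, Summable fun n => (1 - ‖Λ n‖ ^ 2) / ‖ζ j - Λ n‖ ^ (2 * m j)) :
    (∀ v : ℕ → ℂ, (∃ C : ℝ, ∀ n, ‖v n‖ ≤ C) →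
      ∃ (F g : ℂ → ℂ), MemHardy2 g ∧
        (∀ z ∈ ball (0 : ℂ) 1, F z = (∏ j, (z - ζ j) ^ m j) * g z) ∧
        (∃ C : ℝ, ∀ z ∈ ball (0 : ℂ) 1, ‖F z‖ ≤ C) ∧
        ∀ n, F (Λ n) = v n) ∧
    MultInterp ζ m Λ := by
  obtain ⟨C, hCpos, K, hKd, hK1, hK0, hKle, hKsum⟩ := hC.exists_interpolating_kernels hΛ
  obtain ⟨D, hD, u, d, hud, hu1, huD, hule, hds⟩ :=
    exists_damping hζ hζinj hΛ (hC.summable hΛ) hsum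
  have main : ∀ v : ℕ → ℂ, (∃ C : ℝ, ∀ n, ‖v n‖ ≤ C) →
      ∃ (F g : ℂ → ℂ), MemHardy2 g ∧
        (∀ z ∈ ball (0 : ℂ) 1, F z = (∏ j, (z - ζ j) ^ m j) * g z) ∧
        (∃ C : ℝ, ∀ z ∈ ball (0 : ℂ) 1, ‖F z‖ ≤ C) ∧
        ∀ n, F (Λ n) = v n := by
    rintro v ⟨M, hM⟩
    exact exists_interpolant hΛ (hC.summable hΛ) hCpos.le hKd hK1 hK0 hKle hKsum hD.le hud hu1
      huD hule hds hM
  refine ⟨main, fun v hv => ?_⟩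
  obtain ⟨F, g, hg, hF, ⟨M, hM⟩, hv⟩ := main v hv
  exact ⟨F, fun f hf => hf.mul_of_bounded hg hF hM, hv⟩
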